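/- Let p be a prime and ε ∈ ℤ_p^×. Let T₁, …, T_u be pairwise non-ℤ-equivalent positive definite half-integral ternary forms, mutually ℤ_q-equivalent at every prime q, with Gram matrices ℤ_p-equivalent to H ⊕ [p²ε]. Let S₁, …, S_v be pairwise non-ℤ-equivalent positive definite half-integral ternary forms with Gram matrices ℤ_p-equivalent to H ⊕ [p³ε] and ℤ_q-equivalent to p·Gram(T₁) at every prime q ≠ p. Assume that for every j and every subgroup N ≤ ℤ³ of index p on which f_{S_j} takes values in pℤ, the form (1/p)·f_{S_j}|N is ℤ-equivalent to some T_i, and assume the u×v matrix 𝓝 := (r(T_i^p, S_j)/o(S_j)) has rank u. Then for every positive integer n not divisible by p: (r(n, T_i)/o(T_i))_{i=1}^{u} = (𝓝𝓝ᵗ)^{-1}·𝓝·(r(pn, S_j)/o(S_j))_{j=1}^{v}. -/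

import Mathlib

open Matrix

noncomputable section

/-- The image of an integral matrix in the rational matrices. -/
def intMap (X : Matrix (Fin 3) (Fin 3) ℤ) : Matrix (Fin 3) (Fin 3) ℚ :=
  X.map fun a => (a : ℚ)

/-- The value of the quadratic form with Gram matrix `A` at an integral vector `x`. -/
def qf (A : Matrix (Fin 3) (Fin 3) ℚ) (x : Fin 3 → ℤ) : ℚ :=
  (fun i => (x i : ℚ)) ⬝ᵥ A.mulVec fun i => (x i : ℚ)

/-- A rational symmetric matrix is half-integral: integral diagonal, off-diagonal in (1/2)ℤ. -/
def HalfIntegral (A : Matrix (Fin 3) (Fin 3) ℚ) : Prop :=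
  (∀ i, ∃ n : ℤ, A i i = n) ∧ ∀ i j, ∃ n : ℤ, 2 * A i j = n

/-- `A` is symmetric and positive definite. -/
def PosDef3 (A : Matrix (Fin 3) (Fin 3) ℚ) : Prop :=
  A.IsSymm ∧ ∀ x : Fin 3 → ℚ, x ≠ 0 → 0 < x ⬝ᵥ A.mulVec x

/-- `r(K, L)`: the number of representations of the form with Gram matrix `A` by the form
with Gram matrix `B`. -/
def repNum (A B : Matrix (Fin 3) (Fin 3) ℚ) : ℕ :=
  Nat.card {X : Matrix (Fin 3) (Fin 3) ℤ // (intMap X)ᵀ * B * intMap X = A}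

/-- `o(L)`: the number of integral automorphs of the form with Gram matrix `A`. -/
def autNum (A : Matrix (Fin 3) (Fin 3) ℚ) : ℕ :=
  Nat.card {X : Matrix (Fin 3) (Fin 3) ℤ // IsUnit X.det ∧ (intMap X)ᵀ * A * intMap X = A}

/-- `r(n, f)`: the number of representations of the integer `n` by the form with
Gram matrix `A`. -/
def rEval (A : Matrix (Fin 3) (Fin 3) ℚ) (n : ℤ) : ℕ :=
  Nat.card {x : Fin 3 → ℤ // qf A x = (n : ℚ)}

/-- ℤ-equivalence of Gram matrices. -/
def ZEquiv (A B : Matrix (Fin 3) (Fin 3) ℚ) : Prop :=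
  ∃ X : Matrix (Fin 3) (Fin 3) ℤ, IsUnit X.det ∧ (intMap X)ᵀ * A * intMap X = B

/-- The Watson set `Λ_p(A) = {x ∈ ℤ³ : f_A(x + z) ≡ f_A(z) (mod p) for all z ∈ ℤ³}`. -/
def LamSet (p : ℕ) (A : Matrix (Fin 3) (Fin 3) ℚ) : Set (Fin 3 → ℤ) :=
  {x | ∀ z : Fin 3 → ℤ, ∃ k : ℤ, qf A (x + z) - qf A z = (p : ℚ) * k}

/-- ℤ_q-equivalence of rational Gram matrices (inside ℚ_q). -/
def ZqEquiv (q : ℕ) [Fact q.Prime] (A B : Matrix (Fin 3) (Fin 3) ℚ) : Prop :=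
  ∃ X : Matrix (Fin 3) (Fin 3) ℤ_[q], IsUnit X.det ∧
    (X.map fun a => (a : ℚ_[q]))ᵀ * A.map (fun a => (a : ℚ_[q])) * X.map (fun a => (a : ℚ_[q]))
      = B.map fun a => (a : ℚ_[q])

/-- ℤ_q-equivalence of a rational Gram matrix to a q-adic target matrix. -/
def ZpEquivTo (q : ℕ) [Fact q.Prime] (A : Matrix (Fin 3) (Fin 3) ℚ)
    (B : Matrix (Fin 3) (Fin 3) ℚ_[q]) : Prop :=
  ∃ X : Matrix (Fin 3) (Fin 3) ℤ_[q], IsUnit X.det ∧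
    (X.map fun a => (a : ℚ_[q]))ᵀ * A.map (fun a => (a : ℚ_[q])) * X.map (fun a => (a : ℚ_[q])) = B

/-- The block diagonal matrix `H ⊕ [c]` with `H = [[0,1/2],[1/2,0]]`. -/
def Hblock (q : ℕ) [Fact q.Prime] (c : ℚ_[q]) : Matrix (Fin 3) (Fin 3) ℚ_[q] :=
  !![0, 1/2, 0; 1/2, 0, 0; 0, 0, c]

lemma intMap_mul (X Y : Matrix (Fin 3) (Fin 3) ℤ) : intMap (X * Y) = intMap X * intMap Y :=
  Matrix.map_mul (f := Int.castRingHom ℚ)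

lemma intMap_one : intMap 1 = 1 :=
  Matrix.map_one (Int.castRingHom ℚ) (map_zero _) (map_one _)

lemma det_intMap (X : Matrix (Fin 3) (Fin 3) ℤ) : (intMap X).det = (X.det : ℚ) :=
  ((Int.castRingHom ℚ).map_det X).symm

lemma dotProduct_mulVec_mulVec {n R : Type*} [Fintype n] [CommSemiring R] (A B : Matrix n n R)
    (z : n → R) : B.mulVec z ⬝ᵥ A.mulVec (B.mulVec z) = z ⬝ᵥ (Bᵀ * A * B).mulVec z := by
  rw [← Matrix.mulVec_mulVec, ← Matrix.mulVec_mulVec, Matrix.dotProduct_mulVec z,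
    Matrix.vecMul_transpose]

lemma qf_mulVec (A : Matrix (Fin 3) (Fin 3) ℚ) (X : Matrix (Fin 3) (Fin 3) ℤ) (x : Fin 3 → ℤ) :
    qf A (X.mulVec x) = qf ((intMap X)ᵀ * A * intMap X) x := by
  have h : (fun i => ((X.mulVec x i : ℤ) : ℚ)) = (intMap X).mulVec fun i => (x i : ℚ) := by
    ext i
    simp [intMap, Matrix.mulVec, dotProduct]
  rw [qf, h, dotProduct_mulVec_mulVec, qf]

lemma qf_smul (c : ℚ) (A : Matrix (Fin 3) (Fin 3) ℚ) (x : Fin 3 → ℤ) :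
    qf (c • A) x = c * qf A x := by
  simp [qf, Matrix.smul_mulVec]

lemma qf_col (A : Matrix (Fin 3) (Fin 3) ℚ) (X : Matrix (Fin 3) (Fin 3) ℤ) (k : Fin 3) :
    qf A (fun i => X i k) = ((intMap X)ᵀ * A * intMap X) k k := by
  simp [qf, Matrix.mul_apply, intMap, Matrix.mulVec, dotProduct, Fin.sum_univ_three]
  ring

lemma PosDef3.det_ne_zero {A : Matrix (Fin 3) (Fin 3) ℚ} (hA : PosDef3 A) : A.det ≠ 0 := by
  intro h
  obtain ⟨x, hx, hx0⟩ := Matrix.exists_mulVec_eq_zero_iff.mpr h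
  simpa [hx0] using hA.2 x hx

/-- Cauchy–Schwarz for a positive definite ternary form. -/
lemma PosDef3.sq_le {A : Matrix (Fin 3) (Fin 3) ℚ} (hA : PosDef3 A) (x w : Fin 3 → ℚ) :
    (x ⬝ᵥ A.mulVec w) ^ 2 ≤ (x ⬝ᵥ A.mulVec x) * (w ⬝ᵥ A.mulVec w) := by
  by_cases hw : w = 0
  · simp [hw]
  have ha := hA.2 w hw
  have hsymm : w ⬝ᵥ A.mulVec x = x ⬝ᵥ A.mulVec w := by
    rw [Matrix.dotProduct_mulVec, ← Matrix.mulVec_transpose, hA.1.eq, dotProduct_comm]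
  set a := w ⬝ᵥ A.mulVec w
  set b := x ⬝ᵥ A.mulVec w
  set c := x ⬝ᵥ A.mulVec x
  have hv : 0 ≤ (a • x - b • w) ⬝ᵥ A.mulVec (a • x - b • w) := by
    by_cases h : a • x - b • w = 0
    · simp [h]
    · exact (hA.2 _ h).le
  have he : (a • x - b • w) ⬝ᵥ A.mulVec (a • x - b • w) = a * (c * a - b ^ 2) := by
    simp only [Matrix.mulVec_sub, Matrix.mulVec_smul, sub_dotProduct, dotProduct_sub,
      smul_dotProduct, dotProduct_smul, smul_eq_mul, hsymm]
    ring
  rw [he] at hv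
  nlinarith [nonneg_of_mul_nonneg_right hv ha]

lemma PosDef3.finite_qf {A : Matrix (Fin 3) (Fin 3) ℚ} (hA : PosDef3 A) (c : ℚ) :
    Finite {x : Fin 3 → ℤ // qf A x = c} := by
  let w : Fin 3 → Fin 3 → ℚ := fun i => A⁻¹.mulVec (Pi.single i 1)
  let b : Fin 3 → ℤ := fun i => ⌈c * (w i ⬝ᵥ A.mulVec (w i))⌉
  refine Set.Finite.subset (Set.finite_Icc (-b) b) fun x hx => ?_
  have key : ∀ i, x i ^ 2 ≤ b i := by
    intro i
    have h := hA.sq_le (fun i => (x i : ℚ)) (w i)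
    have hAw : A.mulVec (w i) = Pi.single i 1 := by
      rw [Matrix.mulVec_mulVec, Matrix.mul_nonsing_inv _ hA.det_ne_zero.isUnit, Matrix.one_mulVec]
    have hx' : (fun i => (x i : ℚ)) ⬝ᵥ A.mulVec (fun i => (x i : ℚ)) = c := hx
    have h1 : (fun i => (x i : ℚ)) ⬝ᵥ A.mulVec (w i) = x i := by
      rw [hAw]; simp
    rw [h1, hx'] at h
    exact_mod_cast h.trans (Int.le_ceil _)
  refine ⟨fun i => ?_, fun i => ?_⟩
  · simp only [Pi.neg_apply]
    nlinarith [key i, Int.le_self_sq (-x i)]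
  · nlinarith [key i, Int.le_self_sq (x i)]

lemma PosDef3.finite_rep {B : Matrix (Fin 3) (Fin 3) ℚ} (hB : PosDef3 B)
    (A : Matrix (Fin 3) (Fin 3) ℚ) :
    Finite {X : Matrix (Fin 3) (Fin 3) ℤ // (intMap X)ᵀ * B * intMap X = A} := by
  have := fun k => hB.finite_qf (A k k)
  refine Finite.of_injective (β := ∀ k, {x : Fin 3 → ℤ // qf B x = A k k})
    (fun X k => ⟨fun i => X.1 i k, by rw [qf_col, X.2]⟩) fun X Y h => ?_
  ext i k
  exact congrFun (congrArg Subtype.val (congrFun h k)) i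

lemma PosDef3.autNum_ne_zero {A : Matrix (Fin 3) (Fin 3) ℚ} (hA : PosDef3 A) : autNum A ≠ 0 := by
  have := hA.finite_rep A
  have hfin : Finite {X : Matrix (Fin 3) (Fin 3) ℤ //
      IsUnit X.det ∧ (intMap X)ᵀ * A * intMap X = A} :=
    Finite.of_injective (β := {X : Matrix (Fin 3) (Fin 3) ℤ // (intMap X)ᵀ * A * intMap X = A})
      (fun X => ⟨X.1, X.2.2⟩) fun X Y h => Subtype.ext (congrArg (fun Z => Z.1) h)
  have hne : Nonempty {X : Matrix (Fin 3) (Fin 3) ℤ //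
      IsUnit X.det ∧ (intMap X)ᵀ * A * intMap X = A} := ⟨1, by simp, by simp [intMap_one]⟩
  exact Nat.card_pos.ne'

lemma qf_integral {A : Matrix (Fin 3) (Fin 3) ℚ} (hA : PosDef3 A) (hA' : HalfIntegral A)
    (x : Fin 3 → ℤ) : ∃ m : ℤ, qf A x = m := by
  obtain ⟨d0, h0⟩ := hA'.1 0
  obtain ⟨d1, h1⟩ := hA'.1 1
  obtain ⟨d2, h2⟩ := hA'.1 2
  obtain ⟨e0, h01⟩ := hA'.2 0 1
  obtain ⟨e1, h02⟩ := hA'.2 0 2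
  obtain ⟨e2, h12⟩ := hA'.2 1 2
  refine ⟨d0 * x 0 ^ 2 + d1 * x 1 ^ 2 + d2 * x 2 ^ 2 + e0 * x 0 * x 1 + e1 * x 0 * x 2
    + e2 * x 1 * x 2, ?_⟩
  push_cast
  rw [← h0, ← h1, ← h2, ← h01, ← h02, ← h12]
  simp [qf, Matrix.mulVec, dotProduct, Fin.sum_univ_three, hA.1.apply 0 1, hA.1.apply 0 2,
    hA.1.apply 1 2]
  ring

lemma exists_basis_matrix (N : AddSubgroup (Fin 3 → ℤ)) (hN : N.index ≠ 0) :
    ∃ Y : Matrix (Fin 3) (Fin 3) ℤ, ∀ x, x ∈ N ↔ ∃ c, x = Y.mulVec c := by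
  obtain ⟨e⟩ := Int.addSubgroup_index_ne_zero_iff.mp hN
  let f : (Fin 3 → ℤ) →ₗ[ℤ] (Fin 3 → ℤ) := (N.subtype.comp e.symm.toAddMonoidHom).toIntLinearMap
  refine ⟨LinearMap.toMatrix' f, fun x => ?_⟩
  simp only [LinearMap.toMatrix'_mulVec]
  constructor
  · intro hx
    exact ⟨e ⟨x, hx⟩, by simp [f]⟩
  · rintro ⟨c, rfl⟩
    exact (e.symm c).2

/-- The two isotropic directions of `H ⊕ [p³ε]` modulo `p`, as functionals on `ℤ³`. -/
lemma exists_functionals (p : ℕ) [Fact p.Prime] (ε : ℤ_[p]) {S : Matrix (Fin 3) (Fin 3) ℚ}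
    (hS : PosDef3 S) (hS' : HalfIntegral S)
    (hSp : ZpEquivTo p S (Hblock p ((p : ℚ_[p]) ^ 3 * (ε : ℚ_[p])))) :
    ∃ l₀ l₁ : (Fin 3 → ℤ) →+ ZMod p, (∀ a b, ∃ x, l₀ x = a ∧ l₁ x = b) ∧
      ∀ x, ∃ m : ℤ, qf S x = m ∧ (m : ZMod p) = l₀ x * l₁ x ∧
        (l₀ x = 0 → l₁ x = 0 → (p : ℤ) ^ 2 ∣ m) := by
  obtain ⟨P, hP, hPS⟩ := hSp
  let red : ℤ_[p] →+* ZMod p := PadicInt.toZMod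
  let y : Fin 3 → (Fin 3 → ℤ) →+ ℤ_[p] := fun k =>
    { toFun := fun x => P⁻¹.mulVec (fun i => (x i : ℤ_[p])) k
      map_zero' := by simp [Matrix.mulVec, dotProduct]
      map_add' := fun a b => by
        simp [Matrix.mulVec, dotProduct, mul_add, Finset.sum_add_distrib] }
  have hval : ∀ x (m : ℤ), qf S x = m →
      (m : ℤ_[p]) = y 0 x * y 1 x + (p : ℤ_[p]) ^ 3 * ε * y 2 x ^ 2 := by
    intro x m hm
    apply Subtype.coe_injective
    let c : ℤ_[p] →+* ℚ_[p] := PadicInt.Coe.ringHom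
    have hxy : (fun i => (x i : ℚ_[p])) =
        (P.map fun a => (a : ℚ_[p])).mulVec fun k => (y k x : ℚ_[p]) := by
      have h : (fun i => (x i : ℤ_[p])) = P.mulVec fun k => y k x := by
        change _ = P.mulVec (P⁻¹.mulVec _)
        rw [Matrix.mulVec_mulVec, Matrix.mul_nonsing_inv _ hP, Matrix.one_mulVec]
      ext i
      have h' := congrArg c (congrFun h i)
      simp only [c, Matrix.mulVec, dotProduct, map_sum, map_mul, map_intCast] at h'
      exact h'
    have hq : ((qf S x : ℚ) : ℚ_[p]) = (fun i => (x i : ℚ_[p])) ⬝ᵥ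
        (S.map fun a => (a : ℚ_[p])).mulVec fun i => (x i : ℚ_[p]) := by
      simp [qf, Matrix.mulVec, dotProduct]
    rw [hm, hxy] at hq
    rw [dotProduct_mulVec_mulVec, hPS] at hq
    simp only [Rat.cast_intCast] at hq
    push_cast
    rw [hq]
    simp [Hblock, Matrix.mulVec, dotProduct, Fin.sum_univ_three]
    ring
  refine ⟨red.toAddMonoidHom.comp (y 0), red.toAddMonoidHom.comp (y 1), ?_, fun x => ?_⟩
  · intro a b
    have hsurj := ZMod.intCast_surjective (n := p)
    let z : Fin 3 → ZMod p := (P.map red).mulVec ![a, b, 0]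
    choose x hx using fun i => hsurj (z i)
    have hk : ∀ k, red (y k x) = (![a, b, 0] : Fin 3 → ZMod p) k := by
      intro k
      have h1 : red (y k x) = (P⁻¹.map red).mulVec z k := by
        simp [y, Matrix.mulVec, dotProduct, ← hx]
      rw [h1]
      simp only [z]
      rw [Matrix.mulVec_mulVec, ← Matrix.map_mul, Matrix.nonsing_inv_mul _ hP,
        Matrix.map_one _ (map_zero _) (map_one _), Matrix.one_mulVec]
    exact ⟨x, hk 0, hk 1⟩
  · obtain ⟨m, hm⟩ := qf_integral hS hS' x
    have hv := hval x m hm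
    have hdvd : ∀ k, red (y k x) = 0 → (p : ℤ_[p]) ∣ y k x := by
      intro k hk
      rw [← RingHom.mem_ker, PadicInt.ker_toZMod, PadicInt.maximalIdeal_eq_span_p,
        Ideal.mem_span_singleton] at hk
      exact hk
    refine ⟨m, hm, ?_, fun h0 h1 => ?_⟩
    · have h := congrArg red hv
      simpa [red] using h
    · obtain ⟨a, ha⟩ := hdvd 0 h0
      obtain ⟨b, hb⟩ := hdvd 1 h1
      have : ((p : ℤ_[p]) ^ 2) ∣ (m : ℤ_[p]) :=
        ⟨a * b + p * ε * y 2 x ^ 2, by rw [hv, ha, hb]; ring⟩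
      exact_mod_cast (PadicInt.pow_p_dvd_int_iff 2 m).mp this

/-- An integral matrix carrying a ternary form to a locally equivalent one is unimodular. -/
lemma isUnit_det_of_locally_equiv {A B : Matrix (Fin 3) (Fin 3) ℚ} (hA : PosDef3 A)
    (hAB : ∀ q : ℕ, ∀ hq : q.Prime, @ZqEquiv q ⟨hq⟩ A B) {Z : Matrix (Fin 3) (Fin 3) ℤ}
    (hZ : (intMap Z)ᵀ * A * intMap Z = B) : IsUnit Z.det := by
  rw [Int.isUnit_iff_natAbs_eq, Nat.eq_one_iff_not_exists_prime_dvd]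
  intro q hq hdvd
  have : Fact q.Prime := ⟨hq⟩
  obtain ⟨X, hX, hXA⟩ := hAB q hq
  have h1 := congrArg Matrix.det hXA
  have h2 := congrArg Matrix.det hZ
  simp only [Matrix.det_mul, Matrix.det_transpose, det_intMap] at h1 h2
  have hmapA : ∀ C : Matrix (Fin 3) (Fin 3) ℚ,
      (C.map fun a => (a : ℚ_[q])).det = ((C.det : ℚ) : ℚ_[q]) := fun C =>
    ((Rat.castHom ℚ_[q]).map_det C).symm
  have hmapX : (X.map fun a => (a : ℚ_[q])).det = (X.det : ℚ_[q]) :=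
    ((PadicInt.Coe.ringHom (p := q)).map_det X).symm
  rw [hmapA, hmapA, hmapX, ← h2] at h1
  simp only [Rat.cast_mul, Rat.cast_intCast] at h1
  have hA0 : ((A.det : ℚ) : ℚ_[q]) ≠ 0 := Rat.cast_ne_zero.mpr hA.det_ne_zero
  have h3 : (X.det : ℚ_[q]) ^ 2 = (Z.det : ℚ_[q]) ^ 2 :=
    mul_right_cancel₀ hA0 (by linear_combination h1)
  have h4 := congrArg norm h3
  rw [norm_pow, norm_pow, PadicInt.norm_def.symm, PadicInt.isUnit_iff.mp hX] at h4
  have h5 : ‖((Z.det : ℤ) : ℚ_[q])‖ < 1 :=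
    Padic.norm_intCast_lt_one_iff.mpr (Int.natCast_dvd.mpr hdvd)
  nlinarith [norm_nonneg ((Z.det : ℤ) : ℚ_[q])]

lemma repNum_eq_ite {u : ℕ} {T : Fin u → Matrix (Fin 3) (Fin 3) ℚ} (hT : ∀ i, PosDef3 (T i))
    (hTne : ∀ i j, i ≠ j → ¬ ZEquiv (T i) (T j))
    (hTloc : ∀ i j, ∀ q : ℕ, ∀ hq : q.Prime, @ZqEquiv q ⟨hq⟩ (T i) (T j)) (i j : Fin u) :
    repNum (T i) (T j) = if i = j then autNum (T i) else 0 := by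
  have hunit : ∀ Z : Matrix (Fin 3) (Fin 3) ℤ, (intMap Z)ᵀ * T j * intMap Z = T i →
      IsUnit Z.det := fun Z => isUnit_det_of_locally_equiv (hT j) (hTloc j i)
  split_ifs with h
  · subst h
    exact Nat.card_congr (Equiv.subtypeEquivRight fun Z => ⟨fun hZ => ⟨hunit Z hZ, hZ⟩, And.right⟩)
  · have : IsEmpty {Z : Matrix (Fin 3) (Fin 3) ℤ // (intMap Z)ᵀ * T j * intMap Z = T i} :=
      ⟨fun Z => hTne j i (Ne.symm h) ⟨Z.1, hunit Z.1 Z.2, Z.2⟩⟩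
    exact Nat.card_of_isEmpty

lemma det_ne_zero_of_transform {S A : Matrix (Fin 3) (Fin 3) ℚ} {Y : Matrix (Fin 3) (Fin 3) ℤ}
    {p : ℚ} (hp : p ≠ 0) (hA : PosDef3 A) (hY : (intMap Y)ᵀ * S * intMap Y = p • A) :
    Y.det ≠ 0 := by
  intro h
  have h' := congrArg Matrix.det hY
  rw [Matrix.det_mul, det_intMap, h, Matrix.det_smul] at h'
  simp [hp, hA.det_ne_zero] at h'

lemma eq_of_mulVec_eq {Y : Matrix (Fin 3) (Fin 3) ℤ} (hY : Y.det ≠ 0) {c d : Fin 3 → ℤ}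
    (h : Y.mulVec c = Y.mulVec d) : c = d :=
  sub_eq_zero.mp (Matrix.eq_zero_of_mulVec_eq_zero hY (by rw [Matrix.mulVec_sub, h, sub_self]))

lemma eq_of_mul_eq {Y : Matrix (Fin 3) (Fin 3) ℤ} (hY : Y.det ≠ 0)
    {Z W : Matrix (Fin 3) (Fin 3) ℤ} (h : Y * Z = Y * W) : Z = W := by
  refine Matrix.ext_of_mulVec_single fun k => eq_of_mulVec_eq hY ?_
  rw [Matrix.mulVec_mulVec, Matrix.mulVec_mulVec, h]

lemma transform_mul {S A B : Matrix (Fin 3) (Fin 3) ℚ} {Y : Matrix (Fin 3) (Fin 3) ℤ} {p : ℚ}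
    (hp : p ≠ 0) (hY : (intMap Y)ᵀ * S * intMap Y = p • A) (Z : Matrix (Fin 3) (Fin 3) ℤ) :
    (intMap (Y * Z))ᵀ * S * intMap (Y * Z) = p • B ↔ (intMap Z)ᵀ * A * intMap Z = B := by
  have h : (intMap (Y * Z))ᵀ * S * intMap (Y * Z) = p • ((intMap Z)ᵀ * A * intMap Z) := by
    calc _ = (intMap Z)ᵀ * ((intMap Y)ᵀ * S * intMap Y) * intMap Z := by
          simp only [intMap_mul, Matrix.transpose_mul, Matrix.mul_assoc]
      _ = _ := by rw [hY]; simp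
  rw [h]
  exact smul_right_inj hp

lemma exists_eq_mul {Y X : Matrix (Fin 3) (Fin 3) ℤ}
    (h : ∀ c, ∃ d, X.mulVec c = Y.mulVec d) : ∃ Z, X = Y * Z := by
  choose d hd using fun k : Fin 3 => h (Pi.single k 1)
  refine ⟨(Matrix.of d)ᵀ, Matrix.ext_of_mulVec_single fun k => ?_⟩
  rw [hd, ← Matrix.mulVec_mulVec]
  congr 1
  ext i
  simp

section Splitting

variable {p : ℕ} [Fact p.Prime] {S A₀ A₁ : Matrix (Fin 3) (Fin 3) ℚ}
  {l₀ l₁ : (Fin 3 → ℤ) →+ ZMod p} {Y₀ Y₁ : Matrix (Fin 3) (Fin 3) ℤ}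

lemma rEval_eq_add (hA₀ : PosDef3 A₀) (hA₁ : PosDef3 A₁)
    (hval : ∀ x, ∃ m : ℤ, qf S x = m ∧ (m : ZMod p) = l₀ x * l₁ x ∧
      (l₀ x = 0 → l₁ x = 0 → (p : ℤ) ^ 2 ∣ m))
    (hl₀ : ∀ x, l₀ x = 0 ↔ ∃ c, x = Y₀.mulVec c) (hl₁ : ∀ x, l₁ x = 0 ↔ ∃ c, x = Y₁.mulVec c)
    (hY₀ : (intMap Y₀)ᵀ * S * intMap Y₀ = (p : ℚ) • A₀)
    (hY₁ : (intMap Y₁)ᵀ * S * intMap Y₁ = (p : ℚ) • A₁) {n : ℤ} (hn : ¬ (p : ℤ) ∣ n) :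
    rEval S (p * n) = rEval A₀ n + rEval A₁ n := by
  have hp : (p : ℚ) ≠ 0 := Nat.cast_ne_zero.mpr (Fact.out : p.Prime).ne_zero
  have hp' : (p : ℤ) ≠ 0 := Nat.cast_ne_zero.mpr (Fact.out : p.Prime).ne_zero
  have hq₀ : ∀ c, qf S (Y₀.mulVec c) = (p * n : ℤ) ↔ qf A₀ c = n := fun c => by
    rw [qf_mulVec, hY₀, qf_smul]
    push_cast
    exact mul_right_inj' hp
  have hq₁ : ∀ c, qf S (Y₁.mulVec c) = (p * n : ℤ) ↔ qf A₁ c = n := fun c => by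
    rw [qf_mulVec, hY₁, qf_smul]
    push_cast
    exact mul_right_inj' hp
  have := hA₀.finite_qf n
  have := hA₁.finite_qf n
  unfold rEval
  rw [← Nat.card_sum]
  symm
  refine Nat.card_congr (Equiv.ofBijective (Sum.elim
    (fun c => ⟨Y₀.mulVec c.1, (hq₀ c.1).mpr c.2⟩) (fun c => ⟨Y₁.mulVec c.1, (hq₁ c.1).mpr c.2⟩))
    ⟨?_, ?_⟩)
  · have hcross : ∀ c d, qf A₀ c = n → Y₀.mulVec c ≠ Y₁.mulVec d := by
      intro c d hc h
      obtain ⟨m, hm, -, hm2⟩ := hval (Y₀.mulVec c)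
      rw [(hq₀ c).mpr hc, Int.cast_inj] at hm
      have h2 := hm2 ((hl₀ _).mpr ⟨c, rfl⟩) ((hl₁ _).mpr ⟨d, h⟩)
      rw [← hm, sq] at h2
      exact hn (Int.dvd_of_mul_dvd_mul_left hp' h2)
    rintro (c | c) (d | d) h
    · exact congrArg _ (Subtype.ext (eq_of_mulVec_eq (det_ne_zero_of_transform hp hA₀ hY₀)
        (Subtype.ext_iff.mp h)))
    · exact (hcross _ _ c.2 (Subtype.ext_iff.mp h)).elim
    · exact (hcross _ _ d.2 (Subtype.ext_iff.mp h).symm).elim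
    · exact congrArg _ (Subtype.ext (eq_of_mulVec_eq (det_ne_zero_of_transform hp hA₁ hY₁)
        (Subtype.ext_iff.mp h)))
  · rintro ⟨x, hx⟩
    obtain ⟨m, hm, hm1, -⟩ := hval x
    rw [hx, Int.cast_inj] at hm
    rw [← hm] at hm1
    simp only [Int.cast_mul, Int.cast_natCast, CharP.cast_eq_zero, zero_mul] at hm1
    rcases mul_eq_zero.mp hm1.symm with h | h
    · obtain ⟨c, rfl⟩ := (hl₀ x).mp h
      exact ⟨Sum.inl ⟨c, (hq₀ c).mp hx⟩, rfl⟩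
    · obtain ⟨c, rfl⟩ := (hl₁ x).mp h
      exact ⟨Sum.inr ⟨c, (hq₁ c).mp hx⟩, rfl⟩

lemma repNum_eq_add {B : Matrix (Fin 3) (Fin 3) ℚ}
    (hA₀ : PosDef3 A₀) (hA₁ : PosDef3 A₁) (hB : PosDef3 B) (hB' : HalfIntegral B)
    (hAB : ∀ q : ℕ, ∀ hq : q.Prime, @ZqEquiv q ⟨hq⟩ A₀ B)
    (hsurj : ∀ a b, ∃ x, l₀ x = a ∧ l₁ x = b)
    (hval : ∀ x, ∃ m : ℤ, qf S x = m ∧ (m : ZMod p) = l₀ x * l₁ x)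
    (hl₀ : ∀ x, l₀ x = 0 ↔ ∃ c, x = Y₀.mulVec c) (hl₁ : ∀ x, l₁ x = 0 ↔ ∃ c, x = Y₁.mulVec c)
    (hY₀ : (intMap Y₀)ᵀ * S * intMap Y₀ = (p : ℚ) • A₀)
    (hY₁ : (intMap Y₁)ᵀ * S * intMap Y₁ = (p : ℚ) • A₁) :
    repNum ((p : ℚ) • B) S = repNum B A₀ + repNum B A₁ := by
  have hp : (p : ℚ) ≠ 0 := Nat.cast_ne_zero.mpr (Fact.out : p.Prime).ne_zero
  have := hA₀.finite_rep B
  have := hA₁.finite_rep B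
  unfold repNum
  rw [← Nat.card_sum]
  symm
  refine Nat.card_congr (Equiv.ofBijective (Sum.elim
    (fun Z => ⟨Y₀ * Z.1, (transform_mul hp hY₀ Z.1).mpr Z.2⟩)
    (fun Z => ⟨Y₁ * Z.1, (transform_mul hp hY₁ Z.1).mpr Z.2⟩)) ⟨?_, ?_⟩)
  · have hcross : ∀ Z W : Matrix (Fin 3) (Fin 3) ℤ, (intMap Z)ᵀ * A₀ * intMap Z = B →
        Y₀ * Z ≠ Y₁ * W := by
      intro Z W hZ h
      have hu := isUnit_det_of_locally_equiv hA₀ hAB hZ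
      obtain ⟨x, hx0, hx1⟩ := hsurj 0 1
      obtain ⟨c, rfl⟩ := (hl₀ x).mp hx0
      have : l₁ (Y₀.mulVec c) = 0 := (hl₁ _).mpr ⟨W.mulVec (Z⁻¹.mulVec c), by
        rw [Matrix.mulVec_mulVec, Matrix.mulVec_mulVec, ← h,
          Matrix.mul_assoc, Matrix.mul_nonsing_inv _ hu, Matrix.mul_one]⟩
      rw [this] at hx1
      exact zero_ne_one hx1
    rintro (Z | Z) (W | W) h
    · exact congrArg _ (Subtype.ext (eq_of_mul_eq (det_ne_zero_of_transform hp hA₀ hY₀)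
        (Subtype.ext_iff.mp h)))
    · exact (hcross _ _ Z.2 (Subtype.ext_iff.mp h)).elim
    · exact (hcross _ _ W.2 (Subtype.ext_iff.mp h).symm).elim
    · exact congrArg _ (Subtype.ext (eq_of_mul_eq (det_ne_zero_of_transform hp hA₁ hY₁)
        (Subtype.ext_iff.mp h)))
  · rintro ⟨X, hX⟩
    have hprod : ∀ c, l₀ (X.mulVec c) = 0 ∨ l₁ (X.mulVec c) = 0 := by
      intro c
      obtain ⟨m, hm, hm1⟩ := hval (X.mulVec c)
      obtain ⟨k, hk⟩ := qf_integral hB hB' c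
      rw [qf_mulVec, hX, qf_smul, hk] at hm
      have hm' : (p * k : ℤ) = m := by exact_mod_cast hm
      rw [← hm'] at hm1
      simp only [Int.cast_mul, Int.cast_natCast, CharP.cast_eq_zero, zero_mul] at hm1
      exact mul_eq_zero.mp hm1.symm
    have hall : (∀ c, l₀ (X.mulVec c) = 0) ∨ ∀ c, l₁ (X.mulVec c) = 0 := by
      by_contra! ⟨⟨c, hc⟩, ⟨d, hd⟩⟩
      have hc1 := (hprod c).resolve_left hc
      have hd0 := (hprod d).resolve_right hd
      have := hprod (c + d)
      simp [Matrix.mulVec_add, hc1, hd0, hc, hd] at this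
    rcases hall with h | h
    · obtain ⟨Z, rfl⟩ := exists_eq_mul fun c => (hl₀ _).mp (h c)
      exact ⟨Sum.inl ⟨Z, (transform_mul hp hY₀ Z).mp hX⟩, rfl⟩
    · obtain ⟨Z, rfl⟩ := exists_eq_mul fun c => (hl₁ _).mp (h c)
      exact ⟨Sum.inr ⟨Z, (transform_mul hp hY₁ Z).mp hX⟩, rfl⟩

/-- The kernel of a functional modulo `p` whose scaled form lies in the family `T`. -/
lemma exists_matrix_of_functional {u : ℕ} {T : Fin u → Matrix (Fin 3) (Fin 3) ℚ}
    (hdown : ∀ N : AddSubgroup (Fin 3 → ℤ), N.index = p →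
      (∀ x ∈ N, ∃ k : ℤ, qf S x = (p : ℚ) * k) →
      ∀ Y : Matrix (Fin 3) (Fin 3) ℤ, (∀ x, x ∈ N ↔ ∃ c, x = Y.mulVec c) →
        ∃ i, ZEquiv (((p : ℚ))⁻¹ • ((intMap Y)ᵀ * S * intMap Y)) (T i))
    (l : (Fin 3 → ℤ) →+ ZMod p) (hl : Function.Surjective l)
    (hval : ∀ x, l x = 0 → ∃ m : ℤ, qf S x = m ∧ (m : ZMod p) = 0) :
    ∃ (i : Fin u) (Y : Matrix (Fin 3) (Fin 3) ℤ), (∀ x, l x = 0 ↔ ∃ c, x = Y.mulVec c) ∧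
      (intMap Y)ᵀ * S * intMap Y = (p : ℚ) • T i := by
  have hp : p.Prime := Fact.out
  have hindex : l.ker.index = p := by
    rw [AddSubgroup.index_ker, AddMonoidHom.range_eq_top.mpr hl]
    simp
  obtain ⟨Y, hY⟩ := exists_basis_matrix l.ker (by rw [hindex]; exact hp.ne_zero)
  obtain ⟨i, W, hW, hWT⟩ := hdown l.ker hindex (fun x hx => by
    obtain ⟨m, hm, hm0⟩ := hval x hx
    obtain ⟨k, rfl⟩ := (ZMod.intCast_zmod_eq_zero_iff_dvd m p).mp hm0
    exact ⟨k, by rw [hm]; push_cast; rfl⟩) Y hY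
  refine ⟨i, Y * W, fun x => ?_, ?_⟩
  · rw [← AddMonoidHom.mem_ker, hY]
    constructor
    · rintro ⟨c, rfl⟩
      exact ⟨W⁻¹.mulVec c, by
        rw [Matrix.mulVec_mulVec, Matrix.mul_assoc, Matrix.mul_nonsing_inv _ hW, Matrix.mul_one]⟩
    · rintro ⟨c, rfl⟩
      exact ⟨W.mulVec c, (Matrix.mulVec_mulVec _ _ _).symm⟩
  · have hp0 : (p : ℚ) ≠ 0 := Nat.cast_ne_zero.mpr hp.ne_zero
    exact (transform_mul hp0 (smul_inv_smul₀ hp0 _).symm W).mpr hWT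

end Splitting

lemma isUnit_self_mul_transpose_of_rank_eq {u v : ℕ} {M : Matrix (Fin u) (Fin v) ℚ}
    (h : M.rank = u) : IsUnit (M * Mᵀ) := by
  rw [← Matrix.mulVec_surjective_iff_isUnit, ← Matrix.coe_mulVecLin, ← LinearMap.range_eq_top]
  apply Submodule.eq_top_of_finrank_eq
  rw [← Matrix.rank, Matrix.rank_self_mul_transpose, h]
  simp

/-- Theorem 4.7 of the paper, first case (`m = 2`, `p ∤ n`): with `T₁,…,T_u` in
`𝒢_{L,p}(2)`, `S₁,…,S_v` and `𝒢_{L,p}(3)`, closure condition (i), and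
`𝓝 = (r(T_i^p,S_j)/o(S_j))` of rank `u`, for every positive `n` not divisible by `p`:
`R(n, spn(T)) = (𝓝𝓝ᵗ)⁻¹ 𝓝 · R(pn, spn(S))`. -/
theorem stmt_18 (p : ℕ) [Fact p.Prime] (ε : ℤ_[p]ˣ)
    (u v : ℕ) (hu : 0 < u)
    (T : Fin u → Matrix (Fin 3) (Fin 3) ℚ) (S : Fin v → Matrix (Fin 3) (Fin 3) ℚ)
    (hT : ∀ i, PosDef3 (T i) ∧ HalfIntegral (T i))
    (hTne : ∀ i j, i ≠ j → ¬ ZEquiv (T i) (T j))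
    (hTloc : ∀ i j, ∀ q : ℕ, ∀ hq : q.Prime, @ZqEquiv q ⟨hq⟩ (T i) (T j))
    (hTp : ∀ i, ZpEquivTo p (T i) (Hblock p ((p : ℚ_[p]) ^ 2 * ((ε : ℤ_[p]) : ℚ_[p]))))
    (hS : ∀ j, PosDef3 (S j) ∧ HalfIntegral (S j))
    (hSne : ∀ i j, i ≠ j → ¬ ZEquiv (S i) (S j))
    (hSp : ∀ j, ZpEquivTo p (S j) (Hblock p ((p : ℚ_[p]) ^ 3 * ((ε : ℤ_[p]) : ℚ_[p]))))
    (hSloc : ∀ j, ∀ q : ℕ, ∀ hq : q.Prime, q ≠ p →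
      @ZqEquiv q ⟨hq⟩ (S j) ((p : ℚ) • T ⟨0, hu⟩))
    (hdown : ∀ j, ∀ N : AddSubgroup (Fin 3 → ℤ), N.index = p →
      (∀ x ∈ N, ∃ k : ℤ, qf (S j) x = (p : ℚ) * k) →
      ∀ Y : Matrix (Fin 3) (Fin 3) ℤ, (∀ x, x ∈ N ↔ ∃ c, x = Y.mulVec c) →
        ∃ i, ZEquiv (((p : ℚ))⁻¹ • ((intMap Y)ᵀ * S j * intMap Y)) (T i))
    (NN : Matrix (Fin u) (Fin v) ℚ)
    (hNN : NN = Matrix.of fun i j =>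
      (repNum ((p : ℚ) • T i) (S j) : ℚ) / (autNum (S j) : ℚ))
    (hrank : NN.rank = u) :
    ∀ n : ℤ, 0 < n → ¬ (p : ℤ) ∣ n →
      (fun i => (rEval (T i) n : ℚ) / (autNum (T i) : ℚ))
        = ((NN * NNᵀ)⁻¹ * NN).mulVec
            (fun j => (rEval (S j) ((p : ℤ) * n) : ℚ) / (autNum (S j) : ℚ)) := by
  intro n _ hn
  have hR : (fun j => (rEval (S j) ((p : ℤ) * n) : ℚ) / (autNum (S j) : ℚ)) =
      NNᵀ.mulVec fun i => (rEval (T i) n : ℚ) / (autNum (T i) : ℚ) := by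
    ext j
    obtain ⟨l₀, l₁, hsurj, hval⟩ := exists_functionals p ε (hS j).1 (hS j).2 (hSp j)
    obtain ⟨i₀, Y₀, hl₀, hY₀⟩ := exists_matrix_of_functional (hdown j) l₀
      (fun a => (hsurj a 0).imp fun _ h => h.1)
      (fun x hx => (hval x).imp fun _ h => ⟨h.1, by rw [h.2.1, hx, zero_mul]⟩)
    obtain ⟨i₁, Y₁, hl₁, hY₁⟩ := exists_matrix_of_functional (hdown j) l₁
      (fun a => (hsurj 0 a).imp fun _ h => h.2)
      (fun x hx => (hval x).imp fun _ h => ⟨h.1, by rw [h.2.1, hx, mul_zero]⟩)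
    have hrep : ∀ i, repNum ((p : ℚ) • T i) (S j) =
        (if i = i₀ then autNum (T i) else 0) + if i = i₁ then autNum (T i) else 0 := fun i => by
      rw [repNum_eq_add (hT i₀).1 (hT i₁).1 (hT i).1 (hT i).2 (hTloc i₀ i) hsurj
        (fun x => (hval x).imp fun _ h => ⟨h.1, h.2.1⟩) hl₀ hl₁ hY₀ hY₁,
        repNum_eq_ite (fun i => (hT i).1) hTne hTloc, repNum_eq_ite (fun i => (hT i).1) hTne hTloc]
    have hterm : ∀ i, NN i j * ((rEval (T i) n : ℚ) / autNum (T i)) =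
        (if i = i₀ then (rEval (T i) n : ℚ) / autNum (S j) else 0) +
          if i = i₁ then (rEval (T i) n : ℚ) / autNum (S j) else 0 := fun i => by
      have ho : (autNum (T i) : ℚ) ≠ 0 := Nat.cast_ne_zero.mpr (hT i).1.autNum_ne_zero
      rw [hNN, Matrix.of_apply, hrep, div_mul_div_comm, mul_comm (autNum (S j) : ℚ)]
      split_ifs <;> simp [ho, add_mul, add_div, mul_div_mul_left]
    simp only [Matrix.mulVec, dotProduct, Matrix.transpose_apply, hterm, Finset.sum_add_distrib,
      Finset.sum_ite_eq', Finset.mem_univ, if_true]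
    rw [rEval_eq_add (hT i₀).1 (hT i₁).1 hval hl₀ hl₁ hY₀ hY₁ hn, Nat.cast_add, add_div]
  have hunit := (Matrix.isUnit_iff_isUnit_det _).mp (isUnit_self_mul_transpose_of_rank_eq hrank)
  rw [hR, Matrix.mulVec_mulVec, Matrix.mul_assoc, Matrix.nonsing_inv_mul _ hunit,
    Matrix.one_mulVec]
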